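/- Let A be a unital C*-algebra, equipped with its canonical order (0 ≤ x iff x = b* b for some b ∈ A). If for every pair of elements x, y ∈ A with 0 ≤ x and 0 ≤ y one has 0 ≤ x*y + y*x, then A is commutative, i.e., a*b = b*a for all a, b ∈ A. -/

import Mathlib

section Aux

variable {A : Type*} [CStarAlgebra A] [PartialOrder A] [StarOrderedRing A]

/-- The inductive claim: the squared commutator is dominated by the squared anticommutator. -/
def AntiBound (A : Type*) [CStarAlgebra A] [PartialOrder A] (r : ℝ) : Prop :=
  ∀ a b : A, 0 ≤ a → 0 ≤ b →
    r • (-((a * b - b * a) * (a * b - b * a))) ≤ (a * b + b * a) * (a * b + b * a)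

lemma conj_pos {a b : A} (ha : 0 ≤ a) (hb : 0 ≤ b) : 0 ≤ b * a * b := by
  have hb' : star b = b := (IsSelfAdjoint.of_nonneg hb).star_eq
  have := star_left_conjugate_nonneg ha b
  rwa [hb'] at this

lemma antiBound_one (h : ∀ x y : A, 0 ≤ x → 0 ≤ y → 0 ≤ x * y + y * x) :
    AntiBound A 1 := by
  intro a b ha hb
  have h1 := h a (b * a * b) ha (conj_pos ha hb)
  rw [one_smul, ← sub_nonneg]
  have e : (a * b + b * a) * (a * b + b * a) - -((a * b - b * a) * (a * b - b * a))
      = (a * (b * a * b) + b * a * b * a) + (a * (b * a * b) + b * a * b * a) := by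
    noncomm_ring
  rw [e]
  exact add_nonneg h1 h1

lemma antiBound_step (h : ∀ x y : A, 0 ≤ x → 0 ≤ y → 0 ≤ x * y + y * x)
    {r : ℝ} (hr : 1 ≤ r) (H : AntiBound A r) : AntiBound A (Real.sqrt (r ^ 2 + 1)) := by
  intro a b ha hb
  have ha' : star a = a := (IsSelfAdjoint.of_nonneg ha).star_eq
  have hb' : star b = b := (IsSelfAdjoint.of_nonneg hb).star_eq
  have h0 := H a b ha hb
  have h1 := H a (b * a * b) ha (conj_pos ha hb)
  have hs := h a b ha hb
  have e1 : (2 : ℝ) • (a * (b * a * b) - b * a * b * a) =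
      (a * b + b * a) * (a * b - b * a) + (a * b - b * a) * (a * b + b * a) := by
    rw [two_smul]; noncomm_ring
  have e2 : (2 : ℝ) • (a * (b * a * b) + b * a * b * a) =
      (a * b + b * a) * (a * b + b * a) + (a * b - b * a) * (a * b - b * a) := by
    rw [two_smul]; noncomm_ring
  have hk : star (a * b - b * a) = -(a * b - b * a) := by simp [ha', hb']
  have hss : star (a * b + b * a) = a * b + b * a := (IsSelfAdjoint.of_nonneg hs).star_eq
  generalize a * (b * a * b) - b * a * b * a = k' at *
  generalize a * (b * a * b) + b * a * b * a = s' at *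
  generalize a * b - b * a = k at *
  generalize a * b + b * a = s at *
  obtain ⟨D, hD⟩ : ∃ D, D = -(k * k) := ⟨_, rfl⟩
  have hDpos : 0 ≤ D := by
    have := star_mul_self_nonneg k
    rw [hk] at this; simpa [hD] using this
  have hspos : 0 ≤ s * s := by
    have := star_mul_self_nonneg s
    rwa [hss] at this
  have hDsa : star D = D := (IsSelfAdjoint.of_nonneg hDpos).star_eq
  have hD2 : 0 ≤ D * D := by
    have := star_mul_self_nonneg D
    rwa [hDsa] at this
  -- the bound for the new pair, scaled by four
  have h2 : r • (-((s * k + k * s) * (s * k + k * s))) ≤ (s * s - D) * (s * s - D) := by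
    have := smul_le_smul_of_nonneg_left h1 (show (0:ℝ) ≤ 4 by norm_num)
    have f1 : (s * k + k * s) * (s * k + k * s) = (4:ℝ) • (k' * k') := by
      rw [← e1, smul_mul_smul_comm]; norm_num
    have f2 : (s * s - D) * (s * s - D) = (4:ℝ) • (s' * s') := by
      rw [hD, sub_neg_eq_add, ← e2, smul_mul_smul_comm]; norm_num
    rw [f1, f2, ← smul_neg, smul_comm]; exact this
  have hksk : 0 ≤ star k * s * k := star_left_conjugate_nonneg hs k
  have g1 : 0 ≤ s * (star k * s * k) + (star k * s * k) * s := h _ _ hs hksk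
  have g2 : 0 ≤ s * D * s := conj_pos hDpos hs
  have g3 : r • (D * D) ≤ star k * (s * s) * k := by
    have := star_left_conjugate_le_conjugate h0 k
    rw [← hD] at this
    have e : star k * (r • D) * k = r • (D * D) := by
      rw [hk, hD, mul_smul_comm, smul_mul_assoc]; congr 1; noncomm_ring
    rwa [e] at this
  have g4 : r • (D * D) ≤ -((s * k + k * s) * (s * k + k * s)) := by
    have e : -((s * k + k * s) * (s * k + k * s)) =
      star k * (s * s) * k + (s * D * s + (s * (star k * s * k) + (star k * s * k) * s)) := by
      rw [hk, hD]; noncomm_ring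
    rw [e]
    exact g3.trans (le_add_of_nonneg_right (add_nonneg g2 g1))
  have g5 : r • (r • (D * D)) ≤ (s * s - D) * (s * s - D) :=
    (smul_le_smul_of_nonneg_left g4 (by linarith)).trans h2
  have g6 : 0 ≤ D * (s * s - r • D) + (s * s - r • D) * D :=
    h _ _ hDpos (sub_nonneg.2 (by rw [hD]; exact h0))
  have g7 : (r ^ 2 + 1) • (D * D) ≤ (s * s) * (s * s) := by
    have g8 : 0 ≤ (2 * (r - 1)) • (D * D) := smul_nonneg (by linarith) hD2
    have := add_nonneg (add_nonneg (sub_nonneg.2 g5) g6) g8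
    rw [← sub_nonneg]
    convert this using 1
    simp only [mul_sub, sub_mul, mul_smul_comm, smul_mul_assoc]
    module
  have g9 : Real.sqrt (r ^ 2 + 1) • D * Real.sqrt (r ^ 2 + 1) • D ≤ (s * s) * (s * s) := by
    rw [smul_mul_smul_comm, Real.mul_self_sqrt (by positivity)]; exact g7
  have := CFC.sqrt_le_sqrt _ _ g9
  rw [CFC.sqrt_mul_self _ (smul_nonneg (Real.sqrt_nonneg _) hDpos),
    CFC.sqrt_mul_self _ hspos] at this
  rwa [hD] at this

lemma antiBound_nat (h : ∀ x y : A, 0 ≤ x → 0 ≤ y → 0 ≤ x * y + y * x) (n : ℕ) :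
    AntiBound A (Real.sqrt (n + 1)) := by
  induction n with
  | zero => simpa using antiBound_one h
  | succ n ih =>
    have := antiBound_step h (by rw [Real.one_le_sqrt]; linarith [n.cast_nonneg (α := ℝ)]) ih
    rw [Real.sq_sqrt (by positivity)] at this
    exact_mod_cast this

lemma comm_of_nonneg (h : ∀ x y : A, 0 ≤ x → 0 ≤ y → 0 ≤ x * y + y * x)
    {a b : A} (ha : 0 ≤ a) (hb : 0 ≤ b) : a * b = b * a := by
  have ha' : star a = a := (IsSelfAdjoint.of_nonneg ha).star_eq
  have hb' : star b = b := (IsSelfAdjoint.of_nonneg hb).star_eq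
  have hk : star (a * b - b * a) = -(a * b - b * a) := by simp [ha', hb']
  have key := fun n => antiBound_nat h n a b ha hb
  rw [← sub_eq_zero]
  generalize a * b - b * a = k at *
  generalize a * b + b * a = s at *
  have e : -(k * k) = star k * k := by rw [hk]; noncomm_ring
  rw [e] at key
  by_contra hne
  have hpos : 0 < ‖star k * k‖ := by
    rw [CStarRing.norm_star_mul_self]
    have := norm_pos_iff.2 hne
    positivity
  obtain ⟨n, hn⟩ := exists_nat_gt ((‖s * s‖ / ‖star k * k‖) ^ 2)
  have h1 := CStarAlgebra.norm_le_norm_of_nonneg_of_le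
    (smul_nonneg (Real.sqrt_nonneg _) (star_mul_self_nonneg k)) (key n)
  rw [norm_smul, Real.norm_of_nonneg (Real.sqrt_nonneg _), ← le_div_iff₀ hpos] at h1
  have h2 : ((n:ℝ) + 1) ≤ (‖s * s‖ / ‖star k * k‖) ^ 2 := by
    rw [← Real.sq_sqrt (show (0:ℝ) ≤ n + 1 by positivity)]
    gcongr
  linarith

end Aux

/-- If in a unital C*-algebra the anticommutator of any two positive
elements is positive, then the algebra is commutative. -/
theorem commutative_of_anticommutator_nonneg
    {A : Type*} [CStarAlgebra A] [PartialOrder A] [StarOrderedRing A]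
    (h : ∀ x y : A, 0 ≤ x → 0 ≤ y → 0 ≤ x * y + y * x) :
    ∀ a b : A, a * b = b * a := by
  intro a b
  have ha : a ∈ Submodule.span ℂ {x : A | 0 ≤ x} := by
    rw [CStarAlgebra.span_nonneg]; trivial
  have hb : b ∈ Submodule.span ℂ {x : A | 0 ≤ x} := by
    rw [CStarAlgebra.span_nonneg]; trivial
  induction ha using Submodule.span_induction with
  | zero => simp
  | add x y _ _ hx hy => rw [add_mul, mul_add, hx, hy]
  | smul c x _ hx => rw [smul_mul_assoc, mul_smul_comm, hx]
  | mem x hx =>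
    induction hb using Submodule.span_induction with
    | zero => simp
    | add y z _ _ hy hz => rw [add_mul, mul_add, hy, hz]
    | smul c y _ hy => rw [smul_mul_assoc, mul_smul_comm, hy]
    | mem y hy => exact comm_of_nonneg h hx hy
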